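/- With A = B/I and d as above, the Poincaré polynomial of the cohomology H*(A, d) is 1 + 4t + 5t²; that is, dim H⁰ = 1, dim H¹ = 4, dim H² = 5, and Hᵏ = 0 for k ≥ 3. -/

import Mathlib

open ExteriorAlgebra

/-- `B`, the exterior algebra over `ℚ` on the seven generators
`x₁, y₁, x₂, y₂, g₁, g₂, g₃` (indices `0,…,6`). -/
noncomputable abbrev Lam7 : Type := ExteriorAlgebra ℚ (Fin 7 → ℚ)

/-- The generators: `e7 0 = x₁`, `e7 1 = y₁`, `e7 2 = x₂`, `e7 3 = y₂`,
`e7 4 = g₁`, `e7 5 = g₂`, `e7 6 = g₃`. -/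
noncomputable def e7 (i : Fin 7) : Lam7 := ExteriorAlgebra.ι ℚ (Pi.single i 1)

/-- The defining relations of the DGA of the elliptic arrangement
`{ker α₁, ker α₂, ker (α₁ − α₂)}` in `E²`:
`g₂g₃ − g₁g₃ + g₁g₂`, `x₁g₁`, `y₁g₁`, `x₂g₂`, `y₂g₂`, `(x₁−x₂)g₃`, `(y₁−y₂)g₃`. -/
noncomputable def rels7 : Set Lam7 :=
  { e7 5 * e7 6 - e7 4 * e7 6 + e7 4 * e7 5,
    e7 0 * e7 4, e7 1 * e7 4, e7 2 * e7 5, e7 3 * e7 5,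
    (e7 0 - e7 2) * e7 6, (e7 1 - e7 3) * e7 6 }

/-- The two-sided ideal `I` generated by the relations, as a `ℚ`-submodule. -/
noncomputable def idl7 : Submodule ℚ Lam7 :=
  Submodule.span ℚ {x | ∃ a b r : Lam7, r ∈ rels7 ∧ x = a * r * b}

/-- The grading (parity) involution of the exterior algebra, negating each
degree-one generator. -/
noncomputable def sigma7 : Lam7 →ₐ[ℚ] Lam7 := CliffordAlgebra.involute

/-- `d` is the graded derivation of `B` determined by `dxᵢ = dyᵢ = 0`,
`dg₁ = x₁y₁`, `dg₂ = x₂y₂`, `dg₃ = x₁y₁ − x₁y₂ − x₂y₁ + x₂y₂`: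
it satisfies the graded Leibniz rule `d(ab) = (da)b + σ(a)(db)` (with `σ` the
parity involution) and takes the prescribed values on the generators. -/
def IsDiff7 (d : Lam7 →ₗ[ℚ] Lam7) : Prop :=
  (∀ a b : Lam7, d (a * b) = d a * b + sigma7 a * d b) ∧
  d (e7 0) = 0 ∧ d (e7 1) = 0 ∧ d (e7 2) = 0 ∧ d (e7 3) = 0 ∧
  d (e7 4) = e7 0 * e7 1 ∧
  d (e7 5) = e7 2 * e7 3 ∧
  d (e7 6) = e7 0 * e7 1 - e7 0 * e7 3 - e7 2 * e7 1 + e7 2 * e7 3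

/-- The differential induced by `d` on the quotient `A = B/I`. -/
noncomputable def dbar7 (d : Lam7 →ₗ[ℚ] Lam7) (hdi : ∀ x ∈ idl7, d x ∈ idl7) :
    (Lam7 ⧸ idl7) →ₗ[ℚ] Lam7 ⧸ idl7 :=
  Submodule.mapQ idl7 idl7 d (fun x hx => hdi x hx)

/-- The degree-`k` piece `Aᵏ` of `A = B/I`. -/
noncomputable def Apiece7 (k : ℕ) : Submodule ℚ (Lam7 ⧸ idl7) :=
  Submodule.map idl7.mkQ
    ((LinearMap.range (ExteriorAlgebra.ι ℚ : (Fin 7 → ℚ) →ₗ[ℚ] Lam7)) ^ k)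

/-- The degree-`k` cocycles `ker(d : Aᵏ → Aᵏ⁺¹)`. -/
noncomputable def Zpiece7 (d : Lam7 →ₗ[ℚ] Lam7) (hdi : ∀ x ∈ idl7, d x ∈ idl7)
    (k : ℕ) : Submodule ℚ (Lam7 ⧸ idl7) :=
  Apiece7 k ⊓ LinearMap.ker (dbar7 d hdi)

/-- The degree-`k` coboundaries `im(d : Aᵏ⁻¹ → Aᵏ)`. -/
noncomputable def Bpiece7 (d : Lam7 →ₗ[ℚ] Lam7) (hdi : ∀ x ∈ idl7, d x ∈ idl7) :
    ℕ → Submodule ℚ (Lam7 ⧸ idl7)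
  | 0 => ⊥
  | (k + 1) => Submodule.map (dbar7 d hdi) (Apiece7 k)

/-- `dim Hᵏ(A, d)`, the dimension of the degree-`k` cohomology of `(A, d)`. -/
noncomputable def Hdim7 (d : Lam7 →ₗ[ℚ] Lam7) (hdi : ∀ x ∈ idl7, d x ∈ idl7)
    (k : ℕ) : ℕ :=
  Module.finrank ℚ
    (Zpiece7 d hdi k ⧸ Submodule.comap (Zpiece7 d hdi k).subtype (Bpiece7 d hdi k))

/-- `idl7` as a left ideal of `B`; it is two-sided. -/
noncomputable def ideal7 : Ideal Lam7 where
  __ := idl7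
  smul_mem' c x hx := by
    refine Submodule.span_induction (p := fun x _ => c * x ∈ idl7) ?_ ?_ ?_ ?_ hx
    · rintro _ ⟨a, b, r, hr, rfl⟩
      exact Submodule.subset_span ⟨c * a, b, r, hr, by simp only [mul_assoc]⟩
    · simp
    · intro x y _ _ hx hy
      rw [mul_add]
      exact idl7.add_mem hx hy
    · intro t x _ hx
      rw [mul_smul_comm]
      exact idl7.smul_mem t hx

instance : ideal7.IsTwoSided where
  mul_mem_of_left {x} c hx := by
    refine Submodule.span_induction (p := fun x _ => x * c ∈ idl7) ?_ ?_ ?_ ?_ hx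
    · rintro _ ⟨a, b, r, hr, rfl⟩
      exact Submodule.subset_span ⟨a, b * c, r, hr, by simp only [mul_assoc]⟩
    · simp
    · intro x y _ _ hx hy
      rw [add_mul]
      exact idl7.add_mem hx hy
    · intro t x _ hx
      rw [smul_mul_assoc]
      exact idl7.smul_mem t hx

/-- The projection `B → A`, as an algebra homomorphism. -/
noncomputable def proj7 : Lam7 →ₐ[ℚ] Lam7 ⧸ ideal7 := Ideal.Quotient.mkₐ ℚ ideal7

theorem proj7_eq_zero_iff {x : Lam7} : proj7 x = 0 ↔ x ∈ idl7 :=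
  Ideal.Quotient.eq_zero_iff_mem

theorem mkQ_eq_mkQ_iff {x y : Lam7} : idl7.mkQ x = idl7.mkQ y ↔ proj7 x = proj7 y := by
  rw [← sub_eq_zero, ← map_sub, ← sub_eq_zero (b := proj7 y), ← map_sub, proj7_eq_zero_iff]
  exact Submodule.Quotient.mk_eq_zero idl7

theorem mem_idl7_of_mem_rels7 {r : Lam7} (hr : r ∈ rels7) : r ∈ idl7 :=
  Submodule.subset_span ⟨1, 1, r, hr, by simp⟩

theorem e7_mul_self (i : Fin 7) : e7 i * e7 i = 0 := ExteriorAlgebra.ι_sq_zero _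

theorem e7_mul_comm (i j : Fin 7) : e7 i * e7 j = -(e7 j * e7 i) :=
  eq_neg_of_add_eq_zero_left (ExteriorAlgebra.ι_add_mul_swap _ _)

/-- The image of the `i`-th generator in `A`. -/
noncomputable def gen7 (i : Fin 7) : Lam7 ⧸ ideal7 := proj7 (e7 i)

theorem proj7_e7 (i : Fin 7) : proj7 (e7 i) = gen7 i := rfl

theorem gen7_mul_self (i : Fin 7) : gen7 i * gen7 i = 0 := by
  rw [gen7, ← map_mul, e7_mul_self, map_zero]

theorem gen7_swap {i j : Fin 7} (_ : j < i) : gen7 i * gen7 j = -(gen7 j * gen7 i) := by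
  rw [gen7, gen7, ← map_mul, e7_mul_comm, map_neg, map_mul]

theorem gen7_mul_self_mul (i : Fin 7) (m : Lam7 ⧸ ideal7) : gen7 i * (gen7 i * m) = 0 := by
  rw [← mul_assoc, gen7_mul_self, zero_mul]

theorem gen7_swap_mul {i j : Fin 7} (h : j < i) (m : Lam7 ⧸ ideal7) :
    gen7 i * (gen7 j * m) = -(gen7 j * (gen7 i * m)) := by
  rw [← mul_assoc, gen7_swap h, neg_mul, mul_assoc]

theorem gen7_mul_eq_zero {i j : Fin 7}
    (h : (i, j) ∈ [((0 : Fin 7), (4 : Fin 7)), (1, 4), (2, 5), (3, 5)]) : gen7 i * gen7 j = 0 := by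
  rw [gen7, gen7, ← map_mul, proj7_eq_zero_iff]
  apply mem_idl7_of_mem_rels7
  simp only [List.mem_cons, Prod.mk.injEq, List.not_mem_nil, or_false] at h
  rcases h with ⟨rfl, rfl⟩ | ⟨rfl, rfl⟩ | ⟨rfl, rfl⟩ | ⟨rfl, rfl⟩ <;> simp [rels7]

theorem gen7_mul_mul_eq_zero {i j : Fin 7}
    (h : (i, j) ∈ [((0 : Fin 7), (4 : Fin 7)), (1, 4), (2, 5), (3, 5)]) (m : Lam7 ⧸ ideal7) :
    gen7 i * (gen7 j * m) = 0 := by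
  rw [← mul_assoc, gen7_mul_eq_zero h, zero_mul]

theorem gen7_two_six : gen7 2 * gen7 6 = gen7 0 * gen7 6 := by
  rw [eq_comm, ← sub_eq_zero, ← sub_mul]
  simp only [gen7, ← map_mul, ← map_sub, proj7_eq_zero_iff]
  exact mem_idl7_of_mem_rels7 (by simp [rels7])

theorem gen7_three_six : gen7 3 * gen7 6 = gen7 1 * gen7 6 := by
  rw [eq_comm, ← sub_eq_zero, ← sub_mul]
  simp only [gen7, ← map_mul, ← map_sub, proj7_eq_zero_iff]
  exact mem_idl7_of_mem_rels7 (by simp [rels7])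

theorem gen7_five_six : gen7 5 * gen7 6 = gen7 4 * gen7 6 - gen7 4 * gen7 5 := by
  rw [← sub_eq_zero, sub_sub_eq_add_sub, add_sub_right_comm]
  simp only [gen7, ← map_mul, ← map_sub, ← map_add, proj7_eq_zero_iff]
  exact mem_idl7_of_mem_rels7 (by simp [rels7])

theorem gen7_triple_eq_zero {i j k : Fin 7}
    (h : j < k ∧ ((i, k) = (0, 4) ∨ (i, k) = (1, 4)) ∨ i < j ∧ k = 5 ∧ j = 4 ∧ (i = 2 ∨ i = 3)) :
    gen7 i * (gen7 j * gen7 k) = 0 := by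
  rcases h with ⟨hjk, h⟩ | ⟨hij, rfl, rfl, h⟩
  · rw [← neg_neg (gen7 j * gen7 k), ← gen7_swap hjk, mul_neg, gen7_mul_mul_eq_zero, neg_zero]
    rcases h with h | h <;> simp [h]
  · rw [← neg_neg (gen7 i * _), ← gen7_swap_mul hij, gen7_mul_eq_zero, mul_zero, neg_zero]
    rcases h with rfl | rfl <;> simp

theorem gen7_mul_four_six_eq_zero {i : Fin 7} (h : i = 2 ∨ i = 3) :
    gen7 i * (gen7 4 * gen7 6) = 0 := by
  rw [← neg_neg (gen7 i * _), ← gen7_swap_mul (by rcases h with rfl | rfl <;> decide)]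
  rcases h with rfl | rfl
  · rw [gen7_two_six, gen7_swap_mul (by decide), gen7_mul_mul_eq_zero (by simp), neg_zero, neg_zero]
  · rw [gen7_three_six, gen7_swap_mul (by decide), gen7_mul_mul_eq_zero (by simp), neg_zero,
      neg_zero]

theorem gen7_quad_eq_zero {i : Fin 7} (h : i = 0 ∨ i = 1) :
    gen7 i * (gen7 2 * (gen7 3 * gen7 4)) = 0 := by
  rw [← neg_neg (gen7 i * _), ← gen7_swap_mul (by rcases h with rfl | rfl <;> decide),
    gen7_triple_eq_zero, mul_zero, neg_zero]
  rcases h with rfl | rfl <;> simp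

/-- Spanning sets of the graded pieces of `A`, as monomials in `B`. -/
noncomputable def basis7 : ℕ → List Lam7
  | 0 => [1]
  | 1 => [e7 0, e7 1, e7 2, e7 3, e7 4, e7 5, e7 6]
  | 2 => [e7 0 * e7 1, e7 0 * e7 2, e7 0 * e7 3, e7 1 * e7 2, e7 1 * e7 3, e7 2 * e7 3,
      e7 2 * e7 4, e7 3 * e7 4, e7 0 * e7 5, e7 1 * e7 5, e7 0 * e7 6, e7 1 * e7 6,
      e7 4 * e7 5, e7 4 * e7 6]
  | 3 => [e7 0 * (e7 1 * e7 2), e7 0 * (e7 1 * e7 3), e7 0 * (e7 2 * e7 3),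
      e7 1 * (e7 2 * e7 3), e7 2 * (e7 3 * e7 4), e7 0 * (e7 1 * e7 5), e7 0 * (e7 1 * e7 6)]
  | 4 => [e7 0 * (e7 1 * (e7 2 * e7 3))]
  | _ => []

/-- The image in `A` of the span of the monomials of `basis7 k`. -/
noncomputable def span7 (k : ℕ) : Submodule ℚ (Lam7 ⧸ ideal7) :=
  Submodule.span ℚ {x | x ∈ (basis7 k).map proj7}

theorem gen7_mul_mem_span7 {k : ℕ} (i : Fin 7) {m : Lam7} (hm : m ∈ basis7 k) :
    gen7 i * proj7 m ∈ span7 (k + 1) := by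
  have key : ∀ {x}, x ∈ (basis7 (k + 1)).map proj7 → x ∈ span7 (k + 1) :=
    fun h => Submodule.subset_span h
  match k with
  | 0 | 1 | 2 | 3 | 4 =>
    simp only [basis7, List.map_cons, List.map_nil, List.mem_cons, List.not_mem_nil, or_false,
      map_mul, proj7_e7, forall_eq_or_imp, forall_eq, false_imp_iff,
      imp_true_iff] at hm key
    revert m
    simp only [forall_eq_or_imp, forall_eq, map_mul, map_one, proj7_e7, mul_one]
    fin_cases i <;>
    simp [gen7_mul_self, gen7_mul_self_mul, gen7_swap, gen7_swap_mul, gen7_mul_eq_zero,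
      gen7_mul_mul_eq_zero, gen7_two_six, gen7_three_six, gen7_five_six, gen7_triple_eq_zero,
      gen7_quad_eq_zero, gen7_mul_four_six_eq_zero, key, mul_sub, Submodule.sub_mem]
  | k + 5 => simp [basis7] at hm

theorem range_ι_eq_span : LinearMap.range (ExteriorAlgebra.ι ℚ : (Fin 7 → ℚ) →ₗ[ℚ] Lam7) =
    Submodule.span ℚ (Set.range e7) := by
  rw [LinearMap.range_eq_map, ← (Pi.basisFun ℚ (Fin 7)).span_eq, Submodule.map_span,
    ← Set.range_comp]
  congr 2
  ext i
  simp [e7]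

theorem proj7_mem_span7 {k : ℕ} {x : Lam7}
    (hx : x ∈ LinearMap.range (ExteriorAlgebra.ι ℚ : (Fin 7 → ℚ) →ₗ[ℚ] Lam7) ^ k) :
    proj7 x ∈ span7 k := by
  induction k generalizing x with
  | zero =>
    rw [pow_zero, Submodule.one_eq_span] at hx
    obtain ⟨t, rfl⟩ := Submodule.mem_span_singleton.mp hx
    rw [map_smul]
    exact Submodule.smul_mem _ _ (Submodule.subset_span (by simp [basis7]))
  | succ k ih =>
    rw [pow_succ', range_ι_eq_span] at hx
    refine Submodule.mul_induction_on hx (fun v hv m hm => ?_) (fun a b ha hb => ?_)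
    · rw [map_mul]
      refine Submodule.span_induction (p := fun v _ => proj7 v * proj7 m ∈ span7 (k + 1))
        ?_ ?_ ?_ ?_ hv
      · rintro _ ⟨i, rfl⟩
        have hm := ih (by rwa [range_ι_eq_span])
        refine Submodule.span_induction (p := fun y _ => proj7 (e7 i) * y ∈ span7 (k + 1))
          ?_ ?_ ?_ ?_ hm
        · intro y hy
          obtain ⟨m, hm, rfl⟩ := List.mem_map.mp hy
          exact gen7_mul_mem_span7 i hm
        · simp
        · intro a b _ _ ha hb
          rw [mul_add]
          exact add_mem ha hb
        · intro t a _ ha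
          rw [mul_smul_comm]
          exact Submodule.smul_mem _ t ha
      · simp
      · intro a b _ _ ha hb
        rw [map_add, add_mul]
        exact add_mem ha hb
      · intro t a _ ha
        rw [map_smul, smul_mul_assoc]
        exact Submodule.smul_mem _ t ha
    · rw [map_add]
      exact add_mem ha hb

/-- The linear combination of the entries of a list with coefficients `c`. -/
noncomputable def comb7 : (ℕ → ℚ) → List Lam7 → Lam7
  | _, [] => 0
  | c, m :: l => c 0 • m + comb7 (fun i => c (i + 1)) l

theorem comb7_mem {c : ℕ → ℚ} {l : List Lam7} {S : Submodule ℚ Lam7} (h : ∀ m ∈ l, m ∈ S) :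
    comb7 c l ∈ S := by
  induction l generalizing c with
  | nil => exact S.zero_mem
  | cons m l ih =>
    rw [List.forall_mem_cons] at h
    exact S.add_mem (S.smul_mem _ h.1) (ih h.2)

theorem exists_eq_proj7_comb7 {l : List Lam7} {x : Lam7 ⧸ ideal7}
    (hx : x ∈ Submodule.span ℚ {y | y ∈ l.map proj7}) : ∃ c, x = proj7 (comb7 c l) := by
  induction l generalizing x with
  | nil => exact ⟨0, by simpa [comb7] using hx⟩
  | cons m l ih =>
    have h : {y | y ∈ (m :: l).map proj7} = insert (proj7 m) {y | y ∈ l.map proj7} := by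
      ext y
      rw [List.map_cons]
      exact List.mem_cons
    rw [h, Submodule.mem_span_insert] at hx
    obtain ⟨a, z, hz, rfl⟩ := hx
    obtain ⟨c, rfl⟩ := ih hz
    exact ⟨fun i => i.casesOn a c, by simp [comb7]⟩

theorem exists_eq_mkQ_comb7 {k : ℕ} {a : Lam7 ⧸ idl7} (ha : a ∈ Apiece7 k) :
    ∃ c, a = idl7.mkQ (comb7 c (basis7 k)) := by
  obtain ⟨x, hx, rfl⟩ := ha
  obtain ⟨c, hc⟩ := exists_eq_proj7_comb7 (proj7_mem_span7 hx)
  exact ⟨c, mkQ_eq_mkQ_iff.mpr hc⟩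

/-- Substitutions of the generators of `B` under which all the relations vanish: `0` kills the
`g`'s, and `1`, `2`, `3` restrict to the hyperplane of `g₁`, `g₂`, `g₃` respectively. -/
noncomputable def subst7 (j : Fin 4) : Lam7 →ₐ[ℚ] Lam7 :=
  let s : Fin 7 → Fin 7 → ℚ := fun i => Pi.single i 1
  ExteriorAlgebra.map <| Fintype.linearCombination ℚ <|
    (![![s 0, s 1, s 2, s 3, 0, 0, 0], ![0, 0, s 2, s 3, s 4, 0, 0], ![s 0, s 1, 0, 0, 0, s 5, 0],
      ![s 0, s 1, s 0, s 1, 0, 0, s 6]] : Fin 4 → Fin 7 → Fin 7 → ℚ) j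

theorem subst7_e7 (j : Fin 4) (i : Fin 7) : subst7 j (e7 i) =
    (![![e7 0, e7 1, e7 2, e7 3, 0, 0, 0], ![0, 0, e7 2, e7 3, e7 4, 0, 0],
      ![e7 0, e7 1, 0, 0, 0, e7 5, 0], ![e7 0, e7 1, e7 0, e7 1, 0, 0, e7 6]] :
      Fin 4 → Fin 7 → Lam7) j i := by
  rw [subst7, e7, ExteriorAlgebra.map_apply_ι, Fintype.linearCombination_apply_single, one_smul]
  fin_cases j <;> fin_cases i <;> simp [e7]

theorem subst7_eq_zero (j : Fin 4) {x : Lam7} (hx : x ∈ idl7) : subst7 j x = 0 := by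
  refine Submodule.span_induction (p := fun x _ => subst7 j x = 0) ?_ ?_ ?_ ?_ hx
  · rintro _ ⟨a, b, r, hr, rfl⟩
    suffices subst7 j r = 0 by simp [this]
    simp only [rels7, Set.mem_insert_iff, Set.mem_singleton_iff] at hr
    rcases hr with rfl | rfl | rfl | rfl | rfl | rfl | rfl <;> fin_cases j <;> simp [subst7_e7]
  · simp
  · intro x y _ _ hx hy
    rw [map_add, hx, hy, add_zero]
  · intro t x _ hx
    rw [map_smul, hx, smul_zero]

/-- Contraction with the `i`-th coordinate form. -/
noncomputable def contr7 (i : Fin 7) : Lam7 →ₗ[ℚ] Lam7 :=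
  CliffordAlgebra.contractLeft (LinearMap.proj i)

theorem contr7_e7 (i j : Fin 7) : contr7 i (e7 j) = if i = j then 1 else 0 := by
  rw [contr7, e7, ExteriorAlgebra.ι, CliffordAlgebra.contractLeft_ι, LinearMap.proj_apply,
    Pi.single_apply]
  split_ifs <;> simp

theorem contr7_e7_mul (i j : Fin 7) (m : Lam7) :
    contr7 i (e7 j * m) = (if i = j then m else 0) - e7 j * contr7 i m := by
  rw [contr7, e7, ExteriorAlgebra.ι, CliffordAlgebra.contractLeft_ι_mul, LinearMap.proj_apply,
    Pi.single_apply]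
  split_ifs <;> simp

/-- The coefficient of the monomial with list of indices `l` after the substitution `j`. -/
noncomputable def coeff7 (j : Fin 4) (l : List (Fin 7)) : Lam7 →ₗ[ℚ] ℚ :=
  ExteriorAlgebra.algebraMapInv.toLinearMap ∘ₗ l.foldl (fun f i => contr7 i ∘ₗ f)
    (subst7 j).toLinearMap

theorem coeff7_apply (j : Fin 4) (l : List (Fin 7)) (x : Lam7) : coeff7 j l x =
    ExteriorAlgebra.algebraMapInv (l.foldl (fun y i => contr7 i y) (subst7 j x)) := by
  rw [coeff7, LinearMap.comp_apply, AlgHom.toLinearMap_apply]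
  congr 1
  generalize (subst7 j) = f
  change _ = l.foldl _ (f.toLinearMap x)
  generalize f.toLinearMap = g
  induction l generalizing g with
  | nil => rfl
  | cons i l ih => exact ih _

theorem coeff7_eq_zero (j : Fin 4) (l : List (Fin 7)) {x : Lam7} (hx : x ∈ idl7) :
    coeff7 j l x = 0 := by
  have h : ∀ l : List (Fin 7), l.foldl (fun y i => contr7 i y) 0 = 0 := fun l => by
    induction l with
    | nil => rfl
    | cons i l ih => simpa using ih
  rw [coeff7_apply, subst7_eq_zero j hx, h, map_zero]

namespace IsDiff7

variable {d : Lam7 →ₗ[ℚ] Lam7}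

theorem map_one (hd : IsDiff7 d) : d 1 = 0 := by
  simpa using hd.1 1 1

theorem map_e7_mul (hd : IsDiff7 d) (i : Fin 7) (m : Lam7) :
    d (e7 i * m) = d (e7 i) * m - e7 i * d m := by
  rw [hd.1, sub_eq_add_neg, ← neg_mul]
  congr 2
  exact CliffordAlgebra.involute_ι _

theorem map_e7 (hd : IsDiff7 d) (i : Fin 7) : d (e7 i) =
    (![0, 0, 0, 0, e7 0 * e7 1, e7 2 * e7 3,
      e7 0 * e7 1 - e7 0 * e7 3 - e7 2 * e7 1 + e7 2 * e7 3] : Fin 7 → Lam7) i := by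
  obtain ⟨-, h0, h1, h2, h3, h4, h5, h6⟩ := hd
  fin_cases i <;> assumption

end IsDiff7

theorem mem_range_ι_pow_of_mem_basis7 {k : ℕ} {m : Lam7} (hm : m ∈ basis7 k) :
    m ∈ LinearMap.range (ExteriorAlgebra.ι ℚ : (Fin 7 → ℚ) →ₗ[ℚ] Lam7) ^ k := by
  have he : ∀ i, e7 i ∈ LinearMap.range (ExteriorAlgebra.ι ℚ : (Fin 7 → ℚ) →ₗ[ℚ] Lam7) :=
    fun i => LinearMap.mem_range_self _ _
  match k with
  | 0 | 1 | 2 | 3 | 4 =>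
    simp only [basis7, List.mem_cons, List.not_mem_nil, or_false] at hm
    revert m
    simp (maxDischargeDepth := 4) [forall_eq_or_imp, pow_succ', he, Submodule.mul_mem_mul, -LinearMap.mem_range]
  | k + 5 => simp [basis7] at hm

theorem mkQ_mem_Apiece7 {k : ℕ} {m : Lam7} (hm : m ∈ basis7 k) : idl7.mkQ m ∈ Apiece7 k :=
  Submodule.mem_map_of_mem (mem_range_ι_pow_of_mem_basis7 hm)

section Cohomology

variable {d : Lam7 →ₗ[ℚ] Lam7} {hdi : ∀ x ∈ idl7, d x ∈ idl7} {k : ℕ}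

theorem mkQ_mem_Zpiece7 {x : Lam7} (hx : idl7.mkQ x ∈ Apiece7 k) (hd : proj7 (d x) = 0) :
    idl7.mkQ x ∈ Zpiece7 d hdi k :=
  ⟨hx, (Submodule.Quotient.mk_eq_zero idl7).mpr (proj7_eq_zero_iff.mp hd)⟩

theorem mkQ_mem_Bpiece7_succ {x : Lam7} (c : ℕ → ℚ)
    (h : proj7 (d (comb7 c (basis7 k))) = proj7 x) :
    idl7.mkQ x ∈ Bpiece7 d hdi (k + 1) :=
  ⟨idl7.mkQ (comb7 c (basis7 k)),
    Submodule.mem_map_of_mem (comb7_mem fun _ => mem_range_ι_pow_of_mem_basis7),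
    mkQ_eq_mkQ_iff.mpr h⟩

theorem functional_eq_of_mkQ_eq {φ : Lam7 →ₗ[ℚ] ℚ} (hφ : ∀ x ∈ idl7, φ x = 0) {x y : Lam7}
    (h : idl7.mkQ x = idl7.mkQ y) : φ x = φ y := by
  rw [← sub_eq_zero, ← map_sub]
  exact hφ _ ((Submodule.Quotient.eq idl7).mp h)

theorem functional_eq_zero_of_mem_Bpiece7_succ {φ : Lam7 →ₗ[ℚ] ℚ} (hφ : ∀ x ∈ idl7, φ x = 0)
    (h : ∀ m ∈ basis7 k, φ (d m) = 0) {x : Lam7} (hx : idl7.mkQ x ∈ Bpiece7 d hdi (k + 1)) :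
    φ x = 0 := by
  obtain ⟨a, ha, hax⟩ := hx
  obtain ⟨c, rfl⟩ := exists_eq_mkQ_comb7 ha
  rw [← functional_eq_of_mkQ_eq hφ hax]
  exact comb7_mem (S := LinearMap.ker (φ ∘ₗ d)) h

/-- The cohomology has dimension `n` if `n` functionals on cocycles have the coboundaries as their
common kernel and are dual to a family of `n` cocycles. -/
theorem Hdim7_eq_of_functional {n : ℕ}
    (φ : Fin n → Lam7 →ₗ[ℚ] ℚ) (hφ : ∀ i, ∀ x ∈ idl7, φ i x = 0) (w : Fin n → Lam7)
    (hw : ∀ i, idl7.mkQ (w i) ∈ Zpiece7 d hdi k)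
    (hφw : ∀ i j, φ i (w j) = if i = j then 1 else 0)
    (hB : ∀ i x, idl7.mkQ x ∈ Bpiece7 d hdi k → φ i x = 0)
    (hZ : ∀ c : ℕ → ℚ, d (comb7 c (basis7 k)) ∈ idl7 →
      (∀ i, φ i (comb7 c (basis7 k)) = 0) →
      idl7.mkQ (comb7 c (basis7 k)) ∈ Bpiece7 d hdi k) :
    Hdim7 d hdi k = n := by
  let Φ : (Lam7 ⧸ idl7) →ₗ[ℚ] Fin n → ℚ := LinearMap.pi fun i =>
    idl7.liftQ (φ i) fun x hx => hφ i x hx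
  let Ψ : Zpiece7 d hdi k →ₗ[ℚ] Fin n → ℚ := Φ ∘ₗ (Zpiece7 d hdi k).subtype
  have hΨ : ∀ x hx, Ψ ⟨idl7.mkQ x, hx⟩ = fun i => φ i x := fun _ _ => rfl
  have hsurj : Function.Surjective Ψ := by
    intro v
    refine ⟨∑ j, v j • ⟨_, hw j⟩, ?_⟩
    ext i
    simp only [map_sum, map_smul, hΨ, hφw, Finset.sum_apply, Pi.smul_apply, smul_eq_mul]
    simp
  have hker : Submodule.comap (Zpiece7 d hdi k).subtype (Bpiece7 d hdi k) = LinearMap.ker Ψ := by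
    ext ⟨z, hz⟩
    obtain ⟨c, rfl⟩ := exists_eq_mkQ_comb7 hz.1
    rw [LinearMap.mem_ker, hΨ, Submodule.mem_comap, Submodule.subtype_apply, funext_iff]
    exact ⟨fun h i => hB i _ h, hZ c ((Submodule.Quotient.mk_eq_zero idl7).mp hz.2)⟩
  rw [Hdim7, hker, (Ψ.quotKerEquivOfSurjective hsurj).finrank_eq, Module.finrank_fin_fun]

theorem Hdim7_zero (hd : IsDiff7 d) : Hdim7 d hdi 0 = 1 := by
  refine Hdim7_eq_of_functional (fun _ => coeff7 0 []) (fun _ _ => coeff7_eq_zero _ _)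
    (fun _ => 1) (fun _ => mkQ_mem_Zpiece7 (mkQ_mem_Apiece7 (by simp [basis7])) ?_) ?_ ?_ ?_
  · rw [hd.map_one, map_zero]
  · intro i j
    simp [coeff7_apply, Subsingleton.elim i j]
  · intro _ x hx
    exact coeff7_eq_zero _ _ ((Submodule.Quotient.mk_eq_zero idl7).mp hx)
  · intro c _ h
    simp [basis7, comb7, coeff7_apply] at h ⊢
    simp [h]

theorem Hdim7_one (hd : IsDiff7 d) : Hdim7 d hdi 1 = 4 := by
  refine Hdim7_eq_of_functional ![coeff7 0 [0], coeff7 0 [1], coeff7 0 [2], coeff7 0 [3]] ?_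
    ![e7 0, e7 1, e7 2, e7 3] ?_ ?_ ?_ ?_
  · simp +contextual [Fin.forall_fin_succ, coeff7_eq_zero]
  · intro i
    apply mkQ_mem_Zpiece7
    · apply mkQ_mem_Apiece7
      fin_cases i <;> simp [basis7]
    · fin_cases i <;> simp [hd.map_e7]
  · intro i j
    fin_cases i <;> fin_cases j <;> simp [coeff7_apply, subst7_e7, contr7_e7]
  · intro i x hx
    refine functional_eq_zero_of_mem_Bpiece7_succ ?_ ?_ hx
    · fin_cases i <;> exact fun _ => coeff7_eq_zero _ _
    · fin_cases i <;> simp [basis7, hd.map_one]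
  · intro c hc h
    refine mkQ_mem_Bpiece7_succ 0 ?_
    have h1 := coeff7_eq_zero 0 [0, 1] hc
    have h2 := coeff7_eq_zero 0 [2, 3] hc
    have h3 := coeff7_eq_zero 0 [0, 3] hc
    simp [basis7, comb7, Fin.forall_fin_succ, coeff7_apply, subst7_e7, contr7_e7,
      contr7_e7_mul, hd.map_e7] at h h1 h2 h3 ⊢
    have h4 : c 4 = 0 := by linarith
    have h5 : c 5 = 0 := by linarith
    simp [h, h3, h4, h5]

set_option maxHeartbeats 1000000 in
theorem Hdim7_two (hd : IsDiff7 d) : Hdim7 d hdi 2 = 5 := by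
  refine Hdim7_eq_of_functional ![coeff7 0 [0, 2], coeff7 0 [1, 3],
    coeff7 0 [0, 3] + coeff7 0 [1, 2], coeff7 3 [0, 6], coeff7 3 [1, 6]] ?_
    ![e7 0 * e7 2, e7 1 * e7 3, e7 0 * e7 3, e7 0 * e7 6 - e7 2 * e7 4 - e7 0 * e7 5,
      e7 1 * e7 6 - e7 3 * e7 4 - e7 1 * e7 5] ?_ ?_ ?_ ?_
  · simp +contextual [Fin.forall_fin_succ, coeff7_eq_zero]
  · intro i
    apply mkQ_mem_Zpiece7
    · have h : ∀ m ∈ basis7 2, idl7.mkQ m ∈ Apiece7 2 := fun _ => mkQ_mem_Apiece7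
      simp only [basis7, List.forall_mem_cons] at h
      fin_cases i <;> simp only [Fin.reduceFinMk, Matrix.cons_val, map_sub] <;>
        simp [h, Submodule.sub_mem, -Submodule.mkQ_apply]
    · fin_cases i <;> simp [hd.map_e7, hd.map_e7_mul, mul_add, mul_sub, proj7_e7, gen7_swap,
        gen7_mul_self, gen7_mul_self_mul, gen7_swap_mul]
  · intro i j
    fin_cases i <;> fin_cases j <;>
      simp [coeff7_apply, subst7_e7, contr7_e7, contr7_e7_mul]
  · intro i x hx
    refine functional_eq_zero_of_mem_Bpiece7_succ ?_ ?_ hx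
    · fin_cases i <;> simp +contextual [coeff7_eq_zero]
    · fin_cases i <;> simp [basis7, coeff7_apply, subst7_e7, contr7_e7, contr7_e7_mul, hd.map_e7]
  · intro c hc h
    have h1 := coeff7_eq_zero 0 [0, 1, 2] hc
    have h2 := coeff7_eq_zero 0 [0, 1, 3] hc
    have h3 := coeff7_eq_zero 0 [0, 2, 3] hc
    have h4 := coeff7_eq_zero 0 [1, 2, 3] hc
    have h5 := coeff7_eq_zero 1 [2, 3, 4] hc
    have h6 := coeff7_eq_zero 2 [0, 1, 5] hc
    have h7 := coeff7_eq_zero 3 [0, 1, 6] hc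
    refine mkQ_mem_Bpiece7_succ
      (fun i => [0, 0, 0, 0, c 0 + c 2, c 5 + c 2, -c 2].getD i 0) ?_
    simp [basis7, comb7, Fin.forall_fin_succ, coeff7_apply, subst7_e7, contr7_e7, contr7_e7_mul,
      hd.map_e7, hd.map_e7_mul, mul_add, mul_sub, mul_assoc] at h h1 h2 h3 h4 h5 h6 h7 ⊢
    obtain ⟨hc1, hc4, hc3, hc10, hc11⟩ := h
    have hc6 : c 6 = 0 := by linarith
    have hc7 : c 7 = 0 := by linarith
    have hc8 : c 8 = 0 := by linarith
    have hc9 : c 9 = 0 := by linarith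
    simp only [hc1, hc4, hc6, hc7, hc8, hc9, hc10, hc11, h6, h7, eq_neg_of_add_eq_zero_right hc3,
      proj7_e7, gen7_swap (show (1 : Fin 7) < 2 by decide)]
    module

theorem Hdim7_three (hd : IsDiff7 d) : Hdim7 d hdi 3 = 0 := by
  refine Hdim7_eq_of_functional ![] (fun i => i.elim0) ![] (fun i => i.elim0) (fun i => i.elim0)
    (fun i => i.elim0) fun c hc _ => ?_
  have h := coeff7_eq_zero 0 [0, 1, 2, 3] hc
  refine mkQ_mem_Bpiece7_succ
    (fun i => [0, 0, 0, 0, 0, 0, -c 0, -c 1, -c 2, -c 3, 0, 0, c 5, c 6].getD i 0) ?_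
  simp [basis7, comb7, coeff7_apply, subst7_e7, contr7_e7, contr7_e7_mul,
    hd.map_e7, hd.map_e7_mul, mul_add, mul_sub, mul_assoc] at h ⊢
  simp only [eq_neg_of_add_eq_zero_left h, proj7_e7]
  simp [gen7_swap, gen7_swap_mul, gen7_triple_eq_zero]
  module

theorem Hdim7_four (hd : IsDiff7 d) : Hdim7 d hdi 4 = 0 := by
  refine Hdim7_eq_of_functional ![] (fun i => i.elim0) ![] (fun i => i.elim0) (fun i => i.elim0)
    (fun i => i.elim0) fun c _ _ => ?_
  refine mkQ_mem_Bpiece7_succ (fun i => [0, 0, 0, 0, c 0].getD i 0) ?_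
  simp [basis7, comb7, hd.map_e7, hd.map_e7_mul, proj7_e7, gen7_swap, gen7_swap_mul]

theorem Hdim7_of_five_le (k : ℕ) : Hdim7 d hdi (k + 5) = 0 :=
  Hdim7_eq_of_functional ![] (fun i => i.elim0) ![] (fun i => i.elim0) (fun i => i.elim0)
    (fun i => i.elim0) fun _ _ _ => (map_zero idl7.mkQ).symm ▸ Submodule.zero_mem _

end Cohomology

/-- The Poincaré polynomial of `H*(A, d)` is `1 + 4t + 5t²`: `dim H⁰ = 1`,
`dim H¹ = 4`, `dim H² = 5`, and `Hᵏ = 0` for `k ≥ 3`. -/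
theorem poincare_poly_elliptic (d : Lam7 →ₗ[ℚ] Lam7) (hd : IsDiff7 d)
    (hdi : ∀ x ∈ idl7, d x ∈ idl7) :
    Hdim7 d hdi 0 = 1 ∧ Hdim7 d hdi 1 = 4 ∧ Hdim7 d hdi 2 = 5 ∧
    ∀ k ≥ 3, Hdim7 d hdi k = 0 := by
  refine ⟨Hdim7_zero hd, Hdim7_one hd, Hdim7_two hd, fun k hk => ?_⟩
  match k, hk with
  | 3, _ => exact Hdim7_three hd
  | 4, _ => exact Hdim7_four hd
  | k + 5, _ => exact Hdim7_of_five_le k
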